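/- There exists a positive integer N such that for every integer n ≥ N there is a tournament T of order n with inv(T) ≥ n − 2√(n·log₂ n); that is, inv(n) ≥ n − 2√(n·log₂ n) for all sufficiently large n. -/

import Mathlib

/-- An oriented graph: a digraph with no loops and no pair of opposite arcs. -/
structure OrientedGraph (V : Type*) where
  arc : V → V → Prop
  irrefl' : ∀ v, ¬ arc v v
  asymm' : ∀ u v, arc u v → ¬ arc v u

namespace OrientedGraph

variable {V : Type*}

/-- An oriented graph is acyclic if it has no directed cycle. -/
def IsAcyclic (D : OrientedGraph V) : Prop := ∀ v, ¬ Relation.TransGen D.arc v v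

/-- The result of inverting the sets `X 0, …, X (k-1)` one after another:
an arc is reversed iff an odd number of the sets contain both of its end-vertices. -/
def invert (D : OrientedGraph V) {k : ℕ} (X : Fin k → Set V) : OrientedGraph V where
  arc u v := (Even {i : Fin k | u ∈ X i ∧ v ∈ X i}.ncard ∧ D.arc u v) ∨
    (¬ Even {i : Fin k | u ∈ X i ∧ v ∈ X i}.ncard ∧ D.arc v u)
  irrefl' v h := by
    rcases h with ⟨_, h⟩ | ⟨_, h⟩ <;> exact D.irrefl' v h
  asymm' u v h1 h2 := by
    have hs : {i : Fin k | v ∈ X i ∧ u ∈ X i} = {i : Fin k | u ∈ X i ∧ v ∈ X i} := by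
      ext i; simp only [Set.mem_setOf_eq]; exact and_comm
    rcases h1 with ⟨hE, h1⟩ | ⟨hE, h1⟩ <;> rcases h2 with ⟨hE', h2⟩ | ⟨hE', h2⟩ <;>
      rw [hs] at hE'
    · exact D.asymm' u v h1 h2
    · exact hE' hE
    · exact hE hE'
    · exact D.asymm' v u h1 h2

/-- A family of subsets is decycling if inverting it yields an acyclic oriented graph. -/
def IsDecycling (D : OrientedGraph V) {k : ℕ} (X : Fin k → Set V) : Prop :=
  (D.invert X).IsAcyclic

/-- The inversion number: the minimum cardinality of a decycling family. -/
noncomputable def inv (D : OrientedGraph V) : ℕ :=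
  sInf {k | ∃ X : Fin k → Set V, D.IsDecycling X}

/-- A tournament: an oriented graph whose underlying graph is complete. -/
def IsTournament (D : OrientedGraph V) : Prop :=
  ∀ u v : V, u ≠ v → D.arc u v ∨ D.arc v u

/-- The subdigraph induced by a set of vertices. -/
def induce (D : OrientedGraph V) (S : Set V) : OrientedGraph S where
  arc a b := D.arc a b
  irrefl' a := D.irrefl' a
  asymm' a b := D.asymm' a b

/-- The dijoin `L ⇒ R`: disjoint union of `L` and `R` plus all arcs from `L` to `R`. -/
def dijoin {α β : Type*} (L : OrientedGraph α) (R : OrientedGraph β) :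
    OrientedGraph (α ⊕ β) where
  arc x y :=
    match x, y with
    | Sum.inl a, Sum.inl b => L.arc a b
    | Sum.inl _, Sum.inr _ => True
    | Sum.inr _, Sum.inl _ => False
    | Sum.inr a, Sum.inr b => R.arc a b
  irrefl' x := by
    cases x with
    | inl a => exact L.irrefl' a
    | inr b => exact R.irrefl' b
  asymm' x y := by
    cases x <;> cases y
    · exact L.asymm' _ _
    · exact fun _ h => h
    · exact fun h _ => h
    · exact R.asymm' _ _

/-- The oriented graph `△(D)`, obtained from `D` by adding two new vertices `u = inr false`
and `v = inr true`, all arcs from `V(D)` to `u`, the arc `u v`, and all arcs from `v`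
to `V(D)`. -/
def triangleExt (D : OrientedGraph V) : OrientedGraph (V ⊕ Bool) where
  arc x y :=
    match x, y with
    | Sum.inl a, Sum.inl b => D.arc a b
    | Sum.inl _, Sum.inr w => w = false
    | Sum.inr w, Sum.inl _ => w = true
    | Sum.inr w, Sum.inr w' => w = false ∧ w' = true
  irrefl' x := by
    cases x with
    | inl a => exact D.irrefl' a
    | inr w => exact fun h => absurd (h.1.symm.trans h.2) (by decide)
  asymm' x y := by
    cases x <;> cases y <;> intro h1 h2
    · exact D.asymm' _ _ h1 h2
    · exact absurd (h1.symm.trans h2) (by decide)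
    · exact absurd (h2.symm.trans h1) (by decide)
    · exact absurd (h1.2.symm.trans h2.1) (by decide)

end OrientedGraph

/-- `maxInv n` is the maximum of the inversion numbers of tournaments of order `n`. -/
noncomputable def maxInv (n : ℕ) : ℕ :=
  sSup {m | ∃ T : OrientedGraph (Fin n), T.IsTournament ∧ T.inv = m}

namespace InvProof
open OrientedGraph

/-- Tournament associated with a function on unordered pairs. -/
def tourn {n : ℕ} (f : Sym2 (Fin n) → ZMod 2) : OrientedGraph (Fin n) where
  arc u v := (u < v ∧ f s(u, v) = 0) ∨ (v < u ∧ f s(u, v) = 1)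
  irrefl' v h := by simp at h
  asymm' u v h1 h2 := by
    rw [Sym2.eq_swap (a := v) (b := u)] at h2
    rcases h1 with ⟨a, b⟩ | ⟨a, b⟩ <;> rcases h2 with ⟨c, d⟩ | ⟨c, d⟩
    · exact absurd a (not_lt.2 c.le)
    · rw [b] at d; exact absurd d (by decide)
    · rw [b] at d; exact absurd d (by decide)
    · exact absurd a (not_lt.2 c.le)

lemma zmod2_cases (x : ZMod 2) : x = 0 ∨ x = 1 := by
  revert x; decide

lemma tourn_isTournament {n : ℕ} (f : Sym2 (Fin n) → ZMod 2) : (tourn f).IsTournament := by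
  intro u v huv
  have e : s(v, u) = s(u, v) := Sym2.eq_swap
  simp only [tourn, e]
  rcases zmod2_cases (f s(u, v)) with h | h <;> rcases lt_or_gt_of_ne huv with h' | h' <;>
    simp [h, h']

/-- Every oriented graph on `Fin n` admits a decycling family. -/
lemma exists_decycling {n : ℕ} (D : OrientedGraph (Fin n)) :
    ∃ (k : ℕ) (X : Fin k → Set (Fin n)), D.IsDecycling X := by
  classical
  let P := {p : Fin n × Fin n // p.1 < p.2 ∧ D.arc p.2 p.1}
  let e : Fin (Fintype.card P) ≃ P := (Fintype.equivFin P).symm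
  let X : Fin (Fintype.card P) → Set (Fin n) := fun i => {(e i).1.1, (e i).1.2}
  refine ⟨_, X, ?_⟩
  have mem : ∀ (a b : Fin n), a < b → ∀ i, (a ∈ X i ∧ b ∈ X i) ↔ (e i).1 = (a, b) := by
    intro a b hab i
    have hl := (e i).2.1
    simp only [X, Set.mem_insert_iff, Set.mem_singleton_iff, Prod.ext_iff]
    constructor
    · rintro ⟨h1 | h1, h2 | h2⟩
      · omega
      · exact ⟨h1.symm, h2.symm⟩
      · omega
      · omega
    · rintro ⟨h1, h2⟩
      exact ⟨Or.inl h1.symm, Or.inr h2.symm⟩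
  have c1 : ∀ a b : Fin n, a < b → D.arc b a →
      {i | a ∈ X i ∧ b ∈ X i}.ncard = 1 := by
    intro a b hab hD
    rw [Set.ncard_eq_one]
    refine ⟨e.symm ⟨(a, b), hab, hD⟩, ?_⟩
    ext i
    simp only [Set.mem_setOf_eq, Set.mem_singleton_iff]
    rw [mem a b hab, Equiv.eq_symm_apply, Subtype.ext_iff]
  have c0 : ∀ a b : Fin n, a < b → ¬ D.arc b a →
      {i | a ∈ X i ∧ b ∈ X i}.ncard = 0 := by
    intro a b hab hD
    have : {i | a ∈ X i ∧ b ∈ X i} = ∅ := by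
      ext i
      simp only [Set.mem_setOf_eq, Set.mem_empty_iff_false, iff_false]
      rw [mem a b hab]
      intro h
      have := (e i).2.2
      rw [h] at this
      exact hD this
    rw [this, Set.ncard_empty]
  have key : ∀ u v, (D.invert X).arc u v → u < v := by
    intro u v h
    by_contra hn
    have hne : u ≠ v := by
      rintro rfl; exact (D.invert X).irrefl' _ h
    have hvu : v < u := lt_of_le_of_ne (not_lt.1 hn) hne.symm
    have hs : {i | u ∈ X i ∧ v ∈ X i} = {i | v ∈ X i ∧ u ∈ X i} := by
      ext i; exact and_comm
    simp only [OrientedGraph.invert, hs] at h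
    by_cases hD : D.arc u v
    · rw [c1 v u hvu hD] at h
      rcases h with h | h
      · exact absurd h.1 (by decide)
      · exact D.asymm' _ _ hD h.2
    · rw [c0 v u hvu hD] at h
      rcases h with h | h
      · exact hD h.2
      · exact h.1 (by decide)
  intro v hv
  have : ∀ a b, Relation.TransGen (D.invert X).arc a b → a < b := by
    intro a b h
    induction h with
    | single h => exact key _ _ h
    | tail _ h ih => exact ih.trans (key _ _ h)
  exact lt_irrefl _ (this v v hv)

lemma invert_isTournament {n k : ℕ} (D : OrientedGraph (Fin n)) (hD : D.IsTournament)
    (X : Fin k → Set (Fin n)) : (D.invert X).IsTournament := by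
  intro u v huv
  have hs : {i | v ∈ X i ∧ u ∈ X i} = {i | u ∈ X i ∧ v ∈ X i} := by
    ext i; exact and_comm
  simp only [OrientedGraph.invert, hs]
  have := hD u v huv
  tauto

/-- An acyclic tournament has a rank function. -/
lemma exists_rank {n : ℕ} (D : OrientedGraph (Fin n)) (hD : D.IsTournament)
    (hA : D.IsAcyclic) : ∃ r : Fin n → Fin n, ∀ u v, D.arc u v → r u < r v := by
  classical
  have tr : ∀ a b c, D.arc a b → D.arc b c → D.arc a c := by
    intro a b c h1 h2
    by_cases hac : a = c
    · subst hac; exact absurd h2 (D.asymm' _ _ h1)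
    rcases hD a c hac with h | h
    · exact h
    · exact absurd (((Relation.TransGen.single h1).tail h2).tail h) (hA a)
  have lt : ∀ u, (Finset.univ.filter (fun w => D.arc w u)).card < n := by
    intro u
    have : (Finset.univ.filter (fun w => D.arc w u)) ⊂ Finset.univ := by
      rw [Finset.ssubset_univ_iff]
      intro h
      have : u ∈ Finset.univ.filter (fun w => D.arc w u) := by rw [h]; simp
      simp only [Finset.mem_filter, Finset.mem_univ, true_and] at this
      exact D.irrefl' _ this
    simpa using Finset.card_lt_card this
  refine ⟨fun u => ⟨_, lt u⟩, fun u v h => ?_⟩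
  rw [Fin.mk_lt_mk]
  apply Finset.card_lt_card
  rw [Finset.ssubset_iff_of_subset]
  · exact ⟨u, by simpa using h, by simpa using D.irrefl' u⟩
  · intro w hw
    simp only [Finset.mem_filter, Finset.mem_univ, true_and] at hw ⊢
    exact tr _ _ _ hw h

/-- Spanning index set of size exactly `k`. -/
lemma exists_span {n m k : ℕ} (hmk : m ≤ k) (hkn : k ≤ n) (a : Fin n → (Fin m → ZMod 2)) :
    ∃ S : Finset (Fin n), S.card = k ∧
      ∀ i, ∃ c : S → ZMod 2, a i = ∑ j, c j • a j := by
  classical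
  obtain ⟨s, -, hspan, hli⟩ : ∃ s : Set (Fin n), s ⊆ Set.univ ∧
      (∀ i, a i ∈ Submodule.span (ZMod 2) (a '' s)) ∧
      LinearIndependent (ZMod 2) (fun x : s => a x) := by
    obtain ⟨s, hs, hmax⟩ := exists_maximal_linearIndepOn (ZMod 2) a
    refine ⟨s, Set.subset_univ _, fun i => ?_, hs⟩
    by_cases hi : i ∈ s
    · exact Submodule.subset_span ⟨i, hi, rfl⟩
    · obtain ⟨c, hc, h⟩ := hmax i hi
      have := (Submodule.smul_mem_iff _ hc).1 h
      exact this
  have hcard : s.toFinset.card ≤ m := by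
    have := hli.fintype_card_le_finrank
    simpa [Set.toFinset_card] using this
  obtain ⟨S, hsS, hS⟩ := Finset.exists_superset_card_eq (hcard.trans hmk)
    (by simpa using hkn)
  refine ⟨S, hS, fun i => ?_⟩
  have h1 : a i ∈ Submodule.span (ZMod 2) (Set.range (fun j : S => a j)) := by
    refine Submodule.span_mono ?_ (hspan i)
    rintro _ ⟨j, hj, rfl⟩
    exact ⟨⟨j, hsS (by simpa using hj)⟩, rfl⟩
  obtain ⟨c, hc⟩ := (Submodule.mem_span_range_iff_exists_fun _).1 h1
  exact ⟨c, hc.symm⟩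

/-- Codes. -/
abbrev Code (n k : ℕ) : Type :=
  ((Fin n → Fin n) × (Fin n → ZMod 2)) ×
    (Σ S : {S : Finset (Fin n) // S.card = k},
      (Sym2 S.1 → ZMod 2) × (((S.1ᶜ : Finset (Fin n)) × S.1) → ZMod 2))

def coef {n : ℕ} (S : Finset (Fin n))
    (p : ((Sᶜ : Finset (Fin n)) × S) → ZMod 2) (u : Fin n) (j : S) : ZMod 2 :=
  if h : u ∈ S then (if u = j then 1 else 0)
  else p (⟨u, Finset.mem_compl.2 h⟩, j)

def dec {n k : ℕ} (C : Code n k) (u v : Fin n) : ZMod 2 :=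
  (∑ i : C.2.1.1, ∑ j : C.2.1.1,
    coef C.2.1.1 C.2.2.2 u i * coef C.2.1.1 C.2.2.2 v j * C.2.2.1 s(i, j))
  + (if u = v then C.1.2 u else if C.1.1 u < C.1.1 v then 0 else 1)

lemma coef_exists {n m : ℕ} (S : Finset (Fin n)) (a : Fin n → (Fin m → ZMod 2))
    (h : ∀ i, ∃ c : S → ZMod 2, a i = ∑ j, c j • a j) :
    ∃ p : ((Sᶜ : Finset (Fin n)) × S) → ZMod 2,
      ∀ u, a u = ∑ j, coef S p u j • a j := by
  choose c hc using h
  refine ⟨fun x => c x.1 x.2, fun u => ?_⟩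
  by_cases hu : u ∈ S
  · rw [Finset.sum_eq_single (⟨u, hu⟩ : S)]
    · simp [coef, hu]
    · intro b _ hb
      have : u ≠ b := fun h => hb (Subtype.ext h.symm)
      simp [coef, hu, this]
    · simp
  · simp only [coef, hu, dite_false]
    exact hc u

lemma gram {n m : ℕ} (S : Finset (Fin n)) (a : Fin n → (Fin m → ZMod 2))
    (p : ((Sᶜ : Finset (Fin n)) × S) → ZMod 2)
    (h : ∀ u, a u = ∑ j, coef S p u j • a j) (u v : Fin n) :
    a u ⬝ᵥ a v = ∑ i : S, ∑ j : S, coef S p u i * coef S p v j * (a i ⬝ᵥ a j) := by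
  conv_lhs => rw [h u, h v]
  rw [sum_dotProduct]
  refine Finset.sum_congr rfl fun i _ => ?_
  rw [dotProduct_sum]
  refine Finset.sum_congr rfl fun j _ => ?_
  rw [smul_dotProduct, dotProduct_smul, smul_eq_mul, smul_eq_mul, mul_assoc]

lemma exists_code {n m k : ℕ} (hmk : m ≤ k) (hkn : k ≤ n) (f : Sym2 (Fin n) → ZMod 2)
    (X : Fin m → Set (Fin n)) (hX : (tourn f).IsDecycling X) :
    ∃ C : Code n k, ∀ u v, u ≤ v → f s(u, v) = dec C u v := by
  classical
  obtain ⟨r, hr⟩ := exists_rank _ (invert_isTournament _ (tourn_isTournament f) X) hX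
  let a : Fin n → Fin m → ZMod 2 := fun u i => if u ∈ X i then 1 else 0
  have ha : ∀ u v, a u ⬝ᵥ a v = (({i | u ∈ X i ∧ v ∈ X i}.ncard : ℕ) : ZMod 2) := by
    intro u v
    rw [Set.ncard_eq_toFinset_card']
    simp only [a, dotProduct, ← ite_and, mul_ite, mul_one, mul_zero, Finset.sum_boole,
      Set.toFinset_setOf]
    congr 2
    ext i
    simp [and_comm]
  obtain ⟨S, hS, hc⟩ := exists_span hmk hkn a
  obtain ⟨p, hp⟩ := coef_exists S a hc
  let g : Sym2 S → ZMod 2 := Sym2.lift ⟨fun i j => a i ⬝ᵥ a j, fun i j => dotProduct_comm _ _⟩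
  refine ⟨((r, fun u => f s(u, u) - a u ⬝ᵥ a u), ⟨⟨S, hS⟩, (g, p)⟩), fun u v huv => ?_⟩
  have hg := gram S a p hp u v
  simp only [dec]
  change _ = (∑ i : S, ∑ j : S, coef S p u i * coef S p v j * (a i ⬝ᵥ a j)) + _
  rw [← hg]
  by_cases he : u = v
  · subst he; simp
  have hlt : u < v := lt_of_le_of_ne huv he
  have e : s(v, u) = s(u, v) := Sym2.eq_swap
  have hs : {i | v ∈ X i ∧ u ∈ X i} = {i | u ∈ X i ∧ v ∈ X i} := by
    ext i; exact and_comm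
  rw [if_neg he, ha]
  have h01 : (0 : ZMod 2) ≠ 1 := by decide
  have A : ∀ b c : ZMod 2, (b = 0 ∧ c = 0 ∨ b ≠ 0 ∧ c = 1) → c = b + 0 := by decide
  have B : ∀ b c : ZMod 2, (b = 0 ∧ c = 1 ∨ b ≠ 0 ∧ c = 0) → c = b + 1 := by decide
  have hev : Even ({i | u ∈ X i ∧ v ∈ X i}.ncard) ↔
      (({i | u ∈ X i ∧ v ∈ X i}.ncard : ℕ) : ZMod 2) = 0 :=
    (ZMod.natCast_eq_zero_iff_even).symm
  rcases invert_isTournament _ (tourn_isTournament f) X u v he with h | h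
  · rw [if_pos (hr _ _ h)]
    simp only [OrientedGraph.invert, tourn, e, hlt, not_lt.2 hlt.le, hev, true_and, false_and,
      or_false, false_or] at h
    exact A _ _ h
  · rw [if_neg (not_lt.2 (hr _ _ h).le)]
    simp only [OrientedGraph.invert, tourn, e, hs, hlt, not_lt.2 hlt.le, hev, true_and, false_and,
      or_false, false_or] at h
    exact B _ _ h

lemma card_code (n k : ℕ) : Fintype.card (Code n k) ≤
    (n ^ n * 2 ^ n) * (2 ^ n * (2 ^ ((k + 1).choose 2) * 2 ^ ((n - k) * k))) := by
  classical
  rw [Fintype.card_prod, Fintype.card_sigma]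
  have h1 : ∀ S : {S : Finset (Fin n) // S.card = k},
      Fintype.card ((Sym2 S.1 → ZMod 2) × (((S.1ᶜ : Finset (Fin n)) × S.1) → ZMod 2)) =
      (2 ^ ((k + 1).choose 2) * 2 ^ ((n - k) * k)) := by
    rintro ⟨S, hS⟩
    simp [Sym2.card, hS, Finset.card_compl, ZMod.card]
  rw [Finset.sum_congr rfl (fun S _ => h1 S), Finset.sum_const, smul_eq_mul]
  apply Nat.mul_le_mul
  · simp [ZMod.card]
  · apply Nat.mul_le_mul_right
    have := Fintype.card_subtype_le (fun S : Finset (Fin n) => S.card = k)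
    simpa using this

lemma count {n k : ℕ} (hkn : k ≤ n)
    (H : ∀ f : Sym2 (Fin n) → ZMod 2, (tourn f).inv ≤ k) :
    2 ^ ((n + 1).choose 2) ≤
      (n ^ n * 2 ^ n) * (2 ^ n * (2 ^ ((k + 1).choose 2) * 2 ^ ((n - k) * k))) := by
  classical
  have : ∀ f : Sym2 (Fin n) → ZMod 2, ∃ C : Code n k, ∀ u v, u ≤ v → f s(u, v) = dec C u v := by
    intro f
    have hne : {k | ∃ X : Fin k → Set (Fin n), (tourn f).IsDecycling X}.Nonempty :=
      exists_decycling (tourn f)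
    obtain ⟨X, hX⟩ := Nat.sInf_mem hne
    exact exists_code (H f) hkn f X hX
  choose C hC using this
  have inj : Function.Injective C := by
    intro f g hfg
    funext x
    induction x using Sym2.ind with
    | _ u v =>
      rcases le_total u v with h | h
      · rw [hC f u v h, hC g u v h, hfg]
      · rw [Sym2.eq_swap, hC f v u h, hC g v u h, hfg]
  have := (Fintype.card_le_of_injective C inj).trans (card_code n k)
  simpa [Sym2.card, ZMod.card] using this

lemma final {n k : ℕ} (hn : 5 ≤ n) (hkn : k ≤ n)
    (hk : (k : ℝ) ≤ (n : ℝ) - 2 * Real.sqrt ((n : ℝ) * Real.logb 2 (n : ℝ)))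
    (h : 2 ^ ((n + 1).choose 2) ≤
      (n ^ n * 2 ^ n) * (2 ^ n * (2 ^ ((k + 1).choose 2) * 2 ^ ((n - k) * k)))) : False := by
  have hn' : (5 : ℝ) ≤ n := by exact_mod_cast hn
  have hL : 2 < Real.logb 2 (n : ℝ) := by
    rw [Real.lt_logb_iff_rpow_lt (by norm_num) (by linarith)]
    norm_num; linarith
  set L := Real.logb 2 (n : ℝ) with hLdef
  have hsq := Real.sq_sqrt (show 0 ≤ (n : ℝ) * L by nlinarith)
  have hs0 := Real.sqrt_nonneg ((n : ℝ) * L)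
  set s := Real.sqrt ((n : ℝ) * L)
  have h1 : 4 * ((n : ℝ) * L) ≤ ((n : ℝ) - k) ^ 2 := by nlinarith
  have hR : (2 : ℝ) ^ ((n + 1).choose 2) ≤
      ((n : ℝ) ^ n * 2 ^ n) * (2 ^ n * (2 ^ ((k + 1).choose 2) * 2 ^ ((n - k) * k))) := by
    exact_mod_cast h
  have hlog := Real.logb_le_logb_of_le (b := 2) (by norm_num) (by positivity) hR
  have hnn : (n : ℝ) ^ n ≠ 0 := by positivity
  rw [Real.logb_mul (by positivity) (by positivity), Real.logb_mul (by positivity) (by positivity),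
    Real.logb_mul (by positivity) (by positivity), Real.logb_mul (by positivity) (by positivity)]
    at hlog
  simp only [Real.logb_pow, Real.logb_self_eq_one (b := 2) (by norm_num), ← hLdef] at hlog
  have c : ∀ t : ℕ, (((t + 1).choose 2 : ℕ) : ℝ) = (t + 1) * t / 2 := by
    intro t
    rw [Nat.cast_choose_two]; push_cast; ring
  rw [c, c] at hlog
  push_cast [Nat.cast_sub hkn] at hlog
  have hk' : (k : ℝ) ≤ n := by exact_mod_cast hkn
  nlinarith

end InvProof

/-- for all sufficiently large `n` there is a tournament of order `n` with
inversion number at least `n - 2 * √(n * log₂ n)`. -/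
theorem exists_tournament_inv_ge_sub_sqrt :
    ∃ N : ℕ, 0 < N ∧ ∀ n : ℕ, N ≤ n →
      ∃ T : OrientedGraph (Fin n), T.IsTournament ∧
        (n : ℝ) - 2 * Real.sqrt ((n : ℝ) * Real.logb 2 (n : ℝ)) ≤ (T.inv : ℝ) := by
  refine ⟨5, by norm_num, fun n hn => ?_⟩
  by_contra hcon
  push Not at hcon
  have H := fun f => hcon (InvProof.tourn f) (InvProof.tourn_isTournament f)
  have h0 : 0 ≤ (n : ℝ) - 2 * Real.sqrt ((n : ℝ) * Real.logb 2 (n : ℝ)) :=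
    (Nat.cast_nonneg _).trans (H 0).le
  have hk := Nat.floor_le h0
  have hkn : ⌊(n : ℝ) - 2 * Real.sqrt ((n : ℝ) * Real.logb 2 (n : ℝ))⌋₊ ≤ n := by
    have := Real.sqrt_nonneg ((n : ℝ) * Real.logb 2 (n : ℝ))
    have h2 := hk.trans (show _ ≤ (n : ℝ) by linarith)
    exact_mod_cast h2
  exact InvProof.final hn hkn hk (InvProof.count hkn (fun f => Nat.le_floor (H f).le))
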